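/- With \varphi_r as Faddeev's quantum dilogarithm and q = e^{4\pi i/r} for odd r \geq 3, for integers n with (r-1)/2 < n < (2r-1)/2 one has (q;q)_n = \exp(\varphi_r(1/r) - \varphi_r((2n+1)/r - 1) + \log 2). -/

import Mathlib

open Complex Filter

/-- The integrand of Faddeev's quantum dilogarithm, as a function of a complex
variable. -/
noncomputable def phiIntegrand (r : ℕ) (t : ℝ) (z : ℂ) : ℂ :=
  Complex.exp ((2 * t - 1) * z) / (4 * z * Complex.sinh z * Complex.sinh (2 * z / r))

/-- Faddeev's quantum dilogarithm `φ_r(t)`: the integral of `phiIntegrand` along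
the real line, indented above the singularity at `x = 0` by a small semicircle
in the upper half plane (parametrized by `ε * exp(iθ)`, `θ` from `π` to `0`). -/
noncomputable def quantumDilog (r : ℕ) (t : ℝ) : ℂ :=
  limUnder (nhdsWithin 0 (Set.Ioi (0 : ℝ))) (fun ε : ℝ =>
    (∫ x in Set.Iic (-ε), phiIntegrand r t (x : ℂ)) +
    (-∫ θ in (0:ℝ)..Real.pi,
        I * ε * Complex.exp (I * θ) * phiIntegrand r t (ε * Complex.exp (I * θ))) +
    ∫ x in Set.Ici ε, phiIntegrand r t (x : ℂ))

/-- A holomorphic function on the union of two overlapping open convex sets has a primitive. -/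
lemma exists_hasDerivAt_union_of_convex {U V : Set ℂ} {f : ℂ → ℂ} (hUo : IsOpen U)
    (hVo : IsOpen V) (hU : Convex ℝ U) (hV : Convex ℝ V) (hUV : (U ∩ V).Nonempty)
    (hf : DifferentiableOn ℂ f (U ∪ V)) :
    ∃ G : ℂ → ℂ, ∀ z ∈ U ∪ V, HasDerivAt G (f z) z := by
  classical
  obtain ⟨A, hA⟩ := hU.exists_forall_hasDerivWithinAt (hf.mono Set.subset_union_left)
  obtain ⟨B, hB⟩ := hV.exists_forall_hasDerivWithinAt (hf.mono Set.subset_union_right)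
  obtain ⟨c, hc⟩ := hUV
  replace hA : ∀ z ∈ U, HasDerivAt A (f z) z := fun z hz ↦ (hA z hz).hasDerivAt (hUo.mem_nhds hz)
  replace hB : ∀ z ∈ V, HasDerivAt (fun z ↦ B z + (A c - B c)) (f z) z :=
    fun z hz ↦ ((hB z hz).hasDerivAt (hVo.mem_nhds hz)).add_const _
  have hAB : Set.EqOn A (fun z ↦ B z + (A c - B c)) (U ∩ V) :=
    (hUo.inter hVo).eqOn_of_deriv_eq (hU.inter hV).isPreconnected
      (fun z hz ↦ (hA z hz.1).differentiableAt.differentiableWithinAt)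
      (fun z hz ↦ (hB z hz.2).differentiableAt.differentiableWithinAt)
      (fun z hz ↦ by rw [(hA z hz.1).deriv, (hB z hz.2).deriv]) hc (by simp)
  refine ⟨fun z ↦ if z ∈ U then A z else B z + (A c - B c), ?_⟩
  rintro z (hz | hz)
  · refine (hA z hz).congr_of_eventuallyEq ?_
    filter_upwards [hUo.mem_nhds hz] with w hw using if_pos hw
  · refine (hB z hz).congr_of_eventuallyEq ?_
    filter_upwards [hVo.mem_nhds hz] with w hw
    split_ifs with h
    exacts [hAB ⟨h, hw⟩, rfl]

lemma integral_path_eq_sub {G f : ℂ → ℂ} {U : Set ℂ} (hG : ∀ z ∈ U, HasDerivAt G (f z) z)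
    (hf : ContinuousOn f U) {γ γ' : ℝ → ℂ} (hγ : ∀ t, HasDerivAt γ (γ' t) t)
    (hγ' : Continuous γ') {a b : ℝ} (hU : ∀ t ∈ Set.uIcc a b, γ t ∈ U) :
    ∫ t in a..b, γ' t * f (γ t) = G (γ b) - G (γ a) := by
  refine intervalIntegral.integral_eq_sub_of_hasDerivAt (f := fun t ↦ G (γ t)) (fun t ht ↦ ?_) ?_
  · rw [mul_comm]
    exact (hG _ (hU t ht)).comp t (hγ t)
  · have hc : Continuous γ := continuous_iff_continuousAt.2 fun t ↦ (hγ t).continuousAt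
    exact (hγ'.continuousOn.mul (hf.comp hc.continuousOn hU)).intervalIntegrable

/-- The part of the half-plane `im z < π` lying above the graph of `im z = -|re z|`. -/
def wedgeStrip : Set ℂ :=
  {z | -z.re < z.im ∧ z.im < Real.pi} ∪ {z | z.re < z.im ∧ z.im < Real.pi}

lemma isOpen_wedgeStrip_right : IsOpen {z : ℂ | -z.re < z.im ∧ z.im < Real.pi} :=
  (isOpen_lt continuous_re.neg continuous_im).and (isOpen_lt continuous_im continuous_const)

lemma isOpen_wedgeStrip_left : IsOpen {z : ℂ | z.re < z.im ∧ z.im < Real.pi} :=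
  (isOpen_lt continuous_re continuous_im).and (isOpen_lt continuous_im continuous_const)

lemma exists_hasDerivAt_wedgeStrip {f : ℂ → ℂ} (hf : DifferentiableOn ℂ f wedgeStrip) :
    ∃ G : ℂ → ℂ, ∀ z ∈ wedgeStrip, HasDerivAt G (f z) z := by
  refine exists_hasDerivAt_union_of_convex isOpen_wedgeStrip_right isOpen_wedgeStrip_left
    ?_ ?_ ⟨I, ?_⟩ hf
  · refine convex_iff_forall_pos.2 ?_
    rintro x ⟨hx, hx'⟩ y ⟨hy, hy'⟩ a b ha hb hab
    simp only [Set.mem_ofPred_eq, add_re, add_im, real_smul, re_ofReal_mul, im_ofReal_mul]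
    constructor
    · linarith [mul_lt_mul_of_pos_left hx ha, mul_lt_mul_of_pos_left hy hb]
    · calc a * x.im + b * y.im < a * Real.pi + b * Real.pi := by gcongr
        _ = Real.pi := by rw [← add_mul, hab, one_mul]
  · refine convex_iff_forall_pos.2 ?_
    rintro x ⟨hx, hx'⟩ y ⟨hy, hy'⟩ a b ha hb hab
    simp only [Set.mem_ofPred_eq, add_re, add_im, real_smul, re_ofReal_mul, im_ofReal_mul]
    constructor
    · linarith [mul_lt_mul_of_pos_left hx ha, mul_lt_mul_of_pos_left hy hb]
    · calc a * x.im + b * y.im < a * Real.pi + b * Real.pi := by gcongr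
        _ = Real.pi := by rw [← add_mul, hab, one_mul]
  · have := Real.pi_gt_three
    simp; linarith

/-- The integral along the real line, with `[-ε, ε]` replaced by the upper semicircle. -/
noncomputable def indentedIntegral (f : ℂ → ℂ) (ε : ℝ) : ℂ :=
  (∫ x in Set.Iic (-ε), f (x : ℂ)) +
    (-∫ θ in (0:ℝ)..Real.pi,
        I * ε * Complex.exp (I * θ) * f (ε * Complex.exp (I * θ))) +
    ∫ x in Set.Ici ε, f (x : ℂ)

/-- The integral along the horizontal line at height `H`. -/
noncomputable def lineIntegral (f : ℂ → ℂ) (H : ℝ) : ℂ := ∫ x : ℝ, f (x + H * I)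

/-- Exponential decay at both ends of the closed strip `0 ≤ im z ≤ H`. -/
def DecaysOnStrip (f : ℂ → ℂ) (H : ℝ) : Prop :=
  ∀ ε > 0, ∃ K b : ℝ, 0 < b ∧ ∀ z : ℂ, ε ≤ |z.re| → 0 ≤ z.im → z.im ≤ H →
    ‖f z‖ ≤ K * Real.exp (-b * |z.re|)

lemma mem_wedgeStrip_of_re_ne_zero {z : ℂ} (hre : z.re ≠ 0) (h0 : 0 ≤ z.im)
    (h : z.im < Real.pi) : z ∈ wedgeStrip := by
  rcases hre.lt_or_gt with hre | hre
  · exact Or.inr ⟨by linarith, h⟩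
  · exact Or.inl ⟨by linarith, h⟩

lemma mem_wedgeStrip_of_im_pos {z : ℂ} (h0 : 0 < z.im) (h : z.im < Real.pi) :
    z ∈ wedgeStrip := by
  rcases le_total z.re 0 with hre | hre
  · exact Or.inr ⟨by linarith, h⟩
  · exact Or.inl ⟨by linarith, h⟩

section

variable {f : ℂ → ℂ} {H : ℝ}

lemma integrable_exp_neg_mul_abs {b : ℝ} (hb : 0 < b) :
    MeasureTheory.Integrable (fun x : ℝ ↦ Real.exp (-b * |x|)) := by
  rw [← MeasureTheory.integrableOn_univ, ← Set.Iic_union_Ioi (a := (0 : ℝ))]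
  refine MeasureTheory.IntegrableOn.union ?_ ?_
  · refine (integrableOn_exp_mul_Iic hb 0).congr_fun (fun x hx ↦ ?_) measurableSet_Iic
    simp [abs_of_nonpos (Set.mem_Iic.1 hx)]
  · refine (integrableOn_exp_mul_Ioi (neg_lt_zero.2 hb) 0).congr_fun (fun x hx ↦ ?_)
      measurableSet_Ioi
    simp [abs_of_pos (Set.mem_Ioi.1 hx)]

lemma DecaysOnStrip.integrableOn (hd : DecaysOnStrip f H) (hf : ContinuousOn f wedgeStrip)
    (hH : H < Real.pi) {ε h : ℝ} (hε : 0 < ε) (h0 : 0 ≤ h) (hh : h ≤ H) :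
    MeasureTheory.IntegrableOn (fun x : ℝ ↦ f (x + h * I)) {x | ε ≤ |x|} := by
  obtain ⟨K, b, hb, hK⟩ := hd ε hε
  have hm : MeasurableSet {x : ℝ | ε ≤ |x|} := measurableSet_le (by fun_prop) (by fun_prop)
  refine MeasureTheory.Integrable.mono' (g := fun x ↦ K * Real.exp (-b * |x|))
    ((integrable_exp_neg_mul_abs hb).const_mul K).integrableOn ?_ ?_
  · refine ContinuousOn.aestronglyMeasurable (hf.comp (by fun_prop) fun x hx ↦ ?_) hm
    refine mem_wedgeStrip_of_re_ne_zero ?_ (by simpa) (by simp; linarith)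
    have : 0 < |x| := hε.trans_le hx
    simpa using this
  · refine (MeasureTheory.ae_restrict_iff' hm).2 (.of_forall fun x hx ↦ ?_)
    simpa using hK (x + h * I) (by simpa using hx) (by simpa) (by simpa)

lemma DecaysOnStrip.integrable_line (hd : DecaysOnStrip f H) (hf : ContinuousOn f wedgeStrip)
    (h0 : 0 < H) (hH : H < Real.pi) :
    MeasureTheory.Integrable (fun x : ℝ ↦ f (x + H * I)) := by
  have hc : Continuous (fun x : ℝ ↦ f (x + H * I)) :=
    hf.comp_continuous (by fun_prop) fun x ↦ mem_wedgeStrip_of_im_pos (by simpa) (by simpa)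
  rw [← MeasureTheory.integrableOn_univ]
  refine ((hd.integrableOn hf hH one_pos h0.le le_rfl).union
    (hc.integrableOn_Icc (a := -1) (b := 1))).mono_set fun x _ ↦ ?_
  by_cases h : 1 ≤ |x|
  · exact Or.inl h
  · exact Or.inr (abs_le.1 (not_le.1 h).le)

lemma DecaysOnStrip.tendsto_side (hd : DecaysOnStrip f H) (h0 : 0 ≤ H) {σ : ℝ} (hσ : |σ| = 1) :
    Tendsto (fun R : ℝ ↦ ∫ y in (0:ℝ)..H, I * f ((σ * R : ℝ) + y * I)) atTop (nhds 0) := by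
  obtain ⟨K, b, hb, hK⟩ := hd 1 one_pos
  have hlim : Tendsto (fun R : ℝ ↦ K * Real.exp (-(b * R)) * |H - 0|) atTop (nhds 0) := by
    have := (Real.tendsto_exp_neg_atTop_nhds_zero.comp (tendsto_id.const_mul_atTop hb))
    simpa using (this.const_mul K).mul_const |H - 0|
  refine squeeze_zero_norm' ?_ hlim
  filter_upwards [eventually_ge_atTop 1] with R hR
  refine intervalIntegral.norm_integral_le_of_norm_le_const fun y hy ↦ ?_
  rw [Set.uIoc_of_le h0] at hy
  have hR' : |σ * R| = R := by rw [abs_mul, hσ, one_mul, abs_of_pos (by linarith)]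
  have := hK ((σ * R : ℝ) + y * I) (by simpa [← ofReal_mul, hR'] using hR)
    (by simpa [← ofReal_mul] using hy.1.le) (by simpa [← ofReal_mul] using hy.2)
  simpa [← ofReal_mul, hR'] using this

/-- Contour shift: the indented integral equals the integral over a parallel line above. -/
lemma DecaysOnStrip.indentedIntegral_eq (hd : DecaysOnStrip f H)
    (hf : DifferentiableOn ℂ f wedgeStrip) (h0 : 0 < H) (hH : H < Real.pi) {ε : ℝ}
    (hε : 0 < ε) (hεπ : ε < Real.pi) :
    indentedIntegral f ε = lineIntegral f H := by
  obtain ⟨G, hG⟩ := exists_hasDerivAt_wedgeStrip hf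
  have hfc := hf.continuousOn
  have harc : ∫ θ in (0:ℝ)..Real.pi, I * ε * exp (I * θ) * f (ε * exp (I * θ)) =
      G (-ε) - G ε := by
    have := integral_path_eq_sub hG hfc (γ := fun θ : ℝ ↦ ε * exp (I * θ))
      (γ' := fun θ : ℝ ↦ I * ε * exp (I * θ)) (a := 0) (b := Real.pi) (fun θ ↦ ?_)
      (by fun_prop) (fun θ hθ ↦ ?_)
    · rw [this, mul_comm I, exp_pi_mul_I]; simp
    · have h1 : HasDerivAt (fun θ : ℝ ↦ I * (θ : ℂ)) (I * 1) θ :=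
        (hasDerivAt_id (θ : ℂ)).comp_ofReal.const_mul I
      convert! (h1.cexp.const_mul (ε : ℂ)) using 1
      ring
    · rw [Set.uIcc_of_le Real.pi_pos.le] at hθ
      have hre : ((ε : ℂ) * exp (I * θ)).re = ε * Real.cos θ := by
        rw [mul_comm I, re_ofReal_mul, exp_ofReal_mul_I_re]
      have him : ((ε : ℂ) * exp (I * θ)).im = ε * Real.sin θ := by
        rw [mul_comm I, im_ofReal_mul, exp_ofReal_mul_I_im]
      have hs : 0 ≤ Real.sin θ := Real.sin_nonneg_of_nonneg_of_le_pi hθ.1 hθ.2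
      have hlt : ε * Real.sin θ < Real.pi :=
        (mul_le_of_le_one_right hε.le (Real.sin_le_one θ)).trans_lt hεπ
      rcases hs.eq_or_lt with hs | hs
      · refine mem_wedgeStrip_of_re_ne_zero ?_ (by rw [him, ← hs, mul_zero]) (by rwa [him])
        rw [hre]
        have := Real.sin_sq_add_cos_sq θ
        refine mul_ne_zero hε.ne' fun h ↦ ?_
        simp [← hs, h] at this
      · exact mem_wedgeStrip_of_im_pos (by rw [him]; positivity) (by rwa [him])
  have hhor : ∀ (h a b : ℝ), (∀ x ∈ Set.uIcc a b, ((x : ℂ) + h * I) ∈ wedgeStrip) →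
      ∫ x in a..b, f (x + h * I) = G (b + h * I) - G (a + h * I) := fun h a b hx ↦ by
    simpa using integral_path_eq_sub hG hfc (γ := fun x : ℝ ↦ x + h * I) (γ' := fun _ ↦ 1)
      (fun x ↦ (hasDerivAt_id (x : ℂ)).comp_ofReal.add_const _) continuous_const hx
  have hver : ∀ x : ℝ, x ≠ 0 →
      ∫ y in (0:ℝ)..H, I * f (x + y * I) = G (x + H * I) - G x := fun x hx ↦ by
    have := integral_path_eq_sub hG hfc (γ := fun y : ℝ ↦ x + y * I) (γ' := fun _ ↦ I)
      (a := 0) (b := H) (fun y ↦ ?_) continuous_const (fun y hy ↦ ?_)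
    · simpa using this
    · simpa using ((hasDerivAt_id (y : ℂ)).comp_ofReal.mul_const I).const_add (x : ℂ)
    · rw [Set.uIcc_of_le h0.le] at hy
      exact mem_wedgeStrip_of_re_ne_zero (by simpa) (by simpa using hy.1)
        (by simpa using hy.2.trans_lt hH)
  have hreal := hd.integrableOn hfc hH hε le_rfl h0.le
  simp only [ofReal_zero, zero_mul, add_zero] at hreal
  have hleft : Tendsto (fun R : ℝ ↦ G (-ε) - G (-R)) atTop
      (nhds (∫ x in Set.Iic (-ε), f (x : ℂ))) := by
    have := MeasureTheory.intervalIntegral_tendsto_integral_Iic (f := fun x : ℝ ↦ f x) (-ε)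
      (hreal.mono_set fun x hx ↦ ?_) tendsto_neg_atTop_atBot
    · refine this.congr' ?_
      filter_upwards [eventually_ge_atTop ε] with R hR
      have h := hhor 0 (-R) (-ε) fun x hx ↦ ?_
      · simpa using h
      · rw [Set.uIcc_of_le (by linarith)] at hx
        exact mem_wedgeStrip_of_re_ne_zero (by simp; linarith [hx.2]) (by simp)
          (by simpa using Real.pi_pos)
    · exact le_abs.2 (Or.inr (le_neg.1 (Set.mem_Iic.1 hx)))
  have hright : Tendsto (fun R : ℝ ↦ G R - G ε) atTop
      (nhds (∫ x in Set.Ici ε, f (x : ℂ))) := by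
    rw [MeasureTheory.integral_Ici_eq_integral_Ioi]
    have := MeasureTheory.intervalIntegral_tendsto_integral_Ioi (f := fun x : ℝ ↦ f x) ε
      (hreal.mono_set fun x hx ↦ ?_) tendsto_id
    · refine this.congr' ?_
      filter_upwards [eventually_ge_atTop ε] with R hR
      have h := hhor 0 ε R fun x hx ↦ ?_
      · simpa using h
      · rw [Set.uIcc_of_le (by linarith)] at hx
        exact mem_wedgeStrip_of_re_ne_zero (by simp; linarith [hx.1]) (by simp)
          (by simpa using Real.pi_pos)
    · exact le_abs.2 (Or.inl (Set.mem_Ioi.1 hx).le)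
  have hline : Tendsto (fun R : ℝ ↦ G (R + H * I) - G (-R + H * I)) atTop
      (nhds (lineIntegral f H)) := by
    refine (MeasureTheory.intervalIntegral_tendsto_integral (hd.integrable_line hfc h0 hH)
      tendsto_neg_atTop_atBot tendsto_id).congr fun R ↦ ?_
    have h := hhor H (-R) R fun x _ ↦ mem_wedgeStrip_of_im_pos (by simpa) (by simpa)
    simpa using h
  have hsides := (hd.tendsto_side h0.le (σ := 1) (by simp)).sub
    (hd.tendsto_side h0.le (σ := -1) (by simp))
  have hlim := (hline.sub ((hleft.sub_const (G (-ε) - G ε)).add hright)).sub hsides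
  have hzero := hlim.congr' (f₂ := fun _ ↦ (0 : ℂ)) <| by
    filter_upwards [eventually_gt_atTop 0] with R hR
    have h1 := hver (1 * R) (by simpa using hR.ne')
    have h2 := hver (-1 * R) (by simpa using hR.ne')
    rw [h1, h2]
    push_cast
    ring_nf
  have := tendsto_nhds_unique hzero tendsto_const_nhds
  rw [indentedIntegral, harc]
  linear_combination -this

end

lemma sigmoid_two_mul (x : ℝ) :
    Real.sigmoid (2 * x) = Real.exp x / (2 * Real.cosh x) := by
  rw [Real.sigmoid_def, Real.cosh_eq, inv_eq_one_div,
    div_eq_div_iff (by positivity) (by positivity)]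
  have : Real.exp (-x) = Real.exp x * Real.exp (-(2 * x)) := by
    rw [← Real.exp_add]; congr 1; ring
  rw [this]
  ring

lemma one_sub_sigmoid_two_mul (x : ℝ) :
    1 - Real.sigmoid (2 * x) = Real.exp (-x) / (2 * Real.cosh x) := by
  rw [← Real.sigmoid_neg, ← mul_neg, sigmoid_two_mul, Real.cosh_neg]

lemma integral_exp_div_cosh {τ : ℂ} (h0 : 0 < τ.re) (h1 : τ.re < 1) :
    ∫ x : ℝ, exp ((2 * τ - 1) * x) / cosh x = Real.pi / sin (Real.pi * τ) := by
  have hbeta : betaIntegral τ (1 - τ) = Real.pi / sin (Real.pi * τ) := by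
    have := Gamma_mul_Gamma_eq_betaIntegral h0 (t := 1 - τ) (by simpa using h1)
    rwa [Gamma_mul_Gamma_one_sub, add_sub_cancel, Gamma_one, one_mul, eq_comm] at this
  have himage : (fun x : ℝ ↦ Real.sigmoid (2 * x)) '' Set.univ = Set.Ioo 0 1 := by
    rw [Set.image_univ, ← Real.range_sigmoid]
    exact (mul_left_surjective₀ two_ne_zero).range_comp Real.sigmoid
  have hderiv : ∀ x : ℝ, HasDerivAt (fun x : ℝ ↦ Real.sigmoid (2 * x))
      (1 / (2 * Real.cosh x ^ 2)) x := fun x ↦ by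
    convert! (Real.hasDerivAt_sigmoid (2 * x)).comp x ((hasDerivAt_id x).const_mul 2) using 1
    rw [one_sub_sigmoid_two_mul, sigmoid_two_mul, Real.exp_neg]
    have := Real.cosh_pos x
    field_simp
  rw [← hbeta, betaIntegral, intervalIntegral.integral_of_le zero_le_one,
    MeasureTheory.integral_Ioc_eq_integral_Ioo, ← himage,
    MeasureTheory.integral_image_eq_integral_abs_deriv_smul MeasurableSet.univ
      (fun x _ ↦ (hderiv x).hasDerivWithinAt)
      ((Real.sigmoid_injective.comp (mul_right_injective₀ two_ne_zero)).injOn),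
    MeasureTheory.setIntegral_univ]
  congr 1 with x
  have hc := Real.cosh_pos x
  have hlog : ∀ y : ℝ, Real.log (Real.exp y / (2 * Real.cosh x)) =
      y - Real.log (2 * Real.cosh x) := fun y ↦ by
    rw [Real.log_div (Real.exp_ne_zero _) (by positivity), Real.log_exp]
  have hpow : ∀ (y : ℝ) (s : ℂ), ((Real.exp y / (2 * Real.cosh x) : ℝ) : ℂ) ^ s =
      exp ((y - Real.log (2 * Real.cosh x) : ℝ) * s) := fun y s ↦ by
    rw [cpow_def_of_ne_zero (by norm_cast; positivity), ← ofReal_log (by positivity), hlog]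
  have hone : (1 : ℂ) - (Real.sigmoid (2 * x) : ℝ) = ((1 - Real.sigmoid (2 * x) : ℝ) : ℂ) := by
    push_cast; ring
  rw [hone, one_sub_sigmoid_two_mul, sigmoid_two_mul, hpow, hpow, ← exp_add,
    abs_of_pos (by positivity)]
  have hL : exp (Real.log (2 * Real.cosh x) : ℝ) = 2 * cosh x := by
    rw [← ofReal_exp, Real.exp_log (by positivity)]; push_cast; rfl
  have hc' : cosh (x : ℂ) ≠ 0 := by rw [← ofReal_cosh]; exact_mod_cast hc.ne'
  have : ((x - Real.log (2 * Real.cosh x) : ℝ) : ℂ) * (τ - 1) +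
      ((-x - Real.log (2 * Real.cosh x) : ℝ) : ℂ) * (1 - τ - 1) =
      (2 * τ - 1) * x + (Real.log (2 * Real.cosh x) : ℝ) := by
    push_cast; ring
  rw [this, exp_add, hL, real_smul]
  push_cast
  field_simp

lemma sinh_add_half_pi_mul_I (x : ℝ) :
    sinh (x + (Real.pi / 2 : ℝ) * I) = I * cosh x := by
  rw [sinh_add, cosh_mul_I, sinh_mul_I, ← ofReal_cos, ← ofReal_sin, Real.cos_pi_div_two,
    Real.sin_pi_div_two]
  simp [mul_comm]

lemma exp_abs_le_two_mul_cosh (x : ℝ) : Real.exp |x| ≤ 2 * Real.cosh x := by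
  rw [← Real.cosh_abs, Real.cosh_eq]
  linarith [Real.exp_pos (-|x|)]

lemma exp_mul_div_cosh_le {a : ℝ} (x : ℝ) :
    Real.exp (a * x) / Real.cosh x ≤ 2 * Real.exp (-(1 - |a|) * |x|) := by
  rw [div_le_iff₀ (Real.cosh_pos x)]
  calc Real.exp (a * x) ≤ Real.exp (-(1 - |a|) * |x|) * Real.exp |x| := by
        rw [← Real.exp_add, Real.exp_le_exp]
        calc a * x ≤ |a * x| := le_abs_self _
          _ = -(1 - |a|) * |x| + |x| := by rw [abs_mul]; ring
    _ ≤ Real.exp (-(1 - |a|) * |x|) * (2 * Real.cosh x) := by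
        gcongr; exact exp_abs_le_two_mul_cosh x
    _ = _ := by ring

/-- A bound for `exp ((2τ - 1) z) / sinh z` on the line `im z = π / 2`, with
`τ = (a + 1) / 2 + s I`. -/
lemma norm_exp_div_sinh_le {a : ℝ} (s x : ℝ) :
    ‖exp ((a + 2 * s * I) * (x + (Real.pi / 2 : ℝ) * I)) / sinh (x + (Real.pi / 2 : ℝ) * I)‖ ≤
      Real.exp (-(Real.pi * s)) * (2 * Real.exp (-(1 - |a|) * |x|)) := by
  rw [sinh_add_half_pi_mul_I, norm_div, norm_mul, norm_I, one_mul, ← ofReal_cosh, norm_real,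
    Real.norm_of_nonneg (Real.cosh_pos x).le, norm_exp]
  have : ((a + 2 * s * I) * (x + (Real.pi / 2 : ℝ) * I)).re = -(Real.pi * s) + a * x := by
    simp; ring
  rw [this, Real.exp_add, mul_div_assoc]
  gcongr
  exact exp_mul_div_cosh_le x

/-- The integral of `-exp ((2τ - 1) z) / (2 z sinh z)` along `im z = π / 2` is a logarithm of
`1 - exp (2πiτ)`. -/
lemma exp_integral_eq_one_sub_exp {t : ℝ} (h0 : 0 < t) (h1 : t < 1) :
    exp (∫ x : ℝ, -exp ((2 * t - 1) * (x + (Real.pi / 2 : ℝ) * I)) /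
      (2 * (x + (Real.pi / 2 : ℝ) * I) * sinh (x + (Real.pi / 2 : ℝ) * I))) =
      1 - exp (2 * Real.pi * I * t) := by
  obtain ⟨a, rfl⟩ : ∃ a, t = (a + 1) / 2 := ⟨2 * t - 1, by ring⟩
  have ha : |a| < 1 := abs_lt.2 ⟨by linarith, by linarith⟩
  set z : ℝ → ℂ := fun x ↦ x + (Real.pi / 2 : ℝ) * I with hz
  set k : ℝ → ℝ → ℂ := fun s x ↦ exp ((a + 2 * s * I) * z x) / sinh (z x) with hk
  have hzim : ∀ x, 1 ≤ ‖z x‖ := fun x ↦ by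
    have : (z x).im = Real.pi / 2 := by simp [hz]
    have h := abs_im_le_norm (z x)
    rw [this, abs_of_pos (by positivity)] at h
    linarith [Real.pi_gt_three]
  have hz0 : ∀ x, z x ≠ 0 := fun x ↦ norm_pos_iff.1 (one_pos.trans_le (hzim x))
  have hsinh : ∀ x, sinh (z x) ≠ 0 := fun x ↦ by
    rw [hz, sinh_add_half_pi_mul_I, ← ofReal_cosh]
    exact mul_ne_zero I_ne_zero (by exact_mod_cast (Real.cosh_pos x).ne')
  have hcosh : ∀ x : ℝ, cosh (x : ℂ) ≠ 0 := fun x ↦ by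
    rw [← ofReal_cosh]
    exact_mod_cast (Real.cosh_pos x).ne'
  have hzc : Continuous z := by fun_prop
  have hkc : ∀ s, Continuous (k s) := fun s ↦
    (by fun_prop : Continuous fun x ↦ exp ((a + 2 * s * I) * z x)).div (by fun_prop) hsinh
  have hFc : ∀ s, Continuous (fun x ↦ -k s x / (2 * z x)) := fun s ↦
    (hkc s).neg.div (by fun_prop) fun x ↦ mul_ne_zero two_ne_zero (hz0 x)
  have hkb : ∀ s x, ‖k s x‖ ≤ Real.exp (-(Real.pi * s)) * (2 * Real.exp (-(1 - |a|) * |x|)) :=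
    norm_exp_div_sinh_le
  have hFb : ∀ s x, ‖-k s x / (2 * z x)‖ ≤
      Real.exp (-(Real.pi * s)) * (2 * Real.exp (-(1 - |a|) * |x|)) := fun s x ↦ by
    rw [norm_div, norm_neg, norm_mul, RCLike.norm_ofNat]
    exact (div_le_self (norm_nonneg _) (by linarith [hzim x])).trans (hkb s x)
  have hgi : MeasureTheory.Integrable (fun x : ℝ ↦ 2 * Real.exp (-(1 - |a|) * |x|)) :=
    (integrable_exp_neg_mul_abs (by linarith)).const_mul 2
  have hFi : ∀ s, MeasureTheory.Integrable (fun x ↦ -k s x / (2 * z x)) := fun s ↦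
    (hgi.const_mul _).mono' (hFc s).aestronglyMeasurable (.of_forall (hFb s))
  set J : ℝ → ℂ := fun s ↦ ∫ x, -k s x / (2 * z x) with hJ
  set w : ℝ → ℂ := fun s ↦ exp (Real.pi * I * (a + 1 + 2 * s * I)) with hw
  have hw1 : ∀ s, w s - 1 = 2 * I * exp (Real.pi * I * (a + 1 + 2 * s * I) / 2) *
      sin (Real.pi * ((a + 1 + 2 * s * I) / 2)) := fun s ↦ by
    set u : ℂ := Real.pi * ((a + 1 + 2 * s * I) / 2) with hu
    have h1 : Real.pi * I * (a + 1 + 2 * s * I) = u * I + u * I := by rw [hu]; ring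
    have h2 : Real.pi * I * (a + 1 + 2 * s * I) / 2 = u * I := by rw [hu]; ring
    have h3 : exp (u * I) * exp (-u * I) = 1 := by rw [← exp_add]; simp
    simp only [hw]
    rw [h2, h1, exp_add, sin]
    linear_combination (exp (u * I) ^ 2 - exp (u * I) * exp (-u * I)) * I_sq + h3
  have hJ' : ∀ s, HasDerivAt J (-(I * ∫ x, k s x)) s := fun s ↦ by
    have := (hasDerivAt_integral_of_dominated_loc_of_deriv_le (μ := MeasureTheory.volume)
      (F := fun s x ↦ -k s x / (2 * z x)) (F' := fun s x ↦ -(I * k s x))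
      (s := Set.Ioi (s - 1))
      (bound := fun x ↦ Real.exp (-(Real.pi * (s - 1))) * (2 * Real.exp (-(1 - |a|) * |x|)))
      (Ioi_mem_nhds (by linarith)) (.of_forall fun s ↦ (hFc s).aestronglyMeasurable)
      (hFi s) (by fun_prop) (.of_forall fun x y hy ↦ ?_) (hgi.const_mul _)
      (.of_forall fun x y _ ↦ ?_)).2
    · rwa [MeasureTheory.integral_neg, MeasureTheory.integral_const_mul] at this
    · rw [norm_neg, norm_mul, norm_I, one_mul]
      refine (hkb y x).trans ?_
      gcongr
      exact (Set.mem_Ioi.1 hy).le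
    · have h1 : HasDerivAt (fun y : ℝ ↦ (a + 2 * y * I) * z x) (2 * 1 * I * z x) y :=
        (((hasDerivAt_id (y : ℂ)).comp_ofReal.const_mul 2).mul_const I |>.const_add _).mul_const _
      convert! (h1.cexp.div_const (sinh (z x))).neg.div_const (2 * z x) using 1
      have := hz0 x
      simp only [hk]
      field_simp
  have hk_int : ∀ s, ∫ x, k s x = exp (Real.pi * I * (a + 1 + 2 * s * I) / 2) * (-1) *
      (Real.pi / sin (Real.pi * ((a + 1 + 2 * s * I) / 2))) := fun s ↦ by
    rw [← integral_exp_div_cosh (by simp; linarith) (by simp; linarith),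
      ← MeasureTheory.integral_const_mul]
    congr 1 with x
    have h1 : (a + 2 * s * I) * (x + (Real.pi / 2 : ℝ) * I) =
        (2 * ((a + 1 + 2 * s * I) / 2) - 1) * x + Real.pi * I * (a + 1 + 2 * s * I) / 2 +
          -(Real.pi / 2 * I) := by
      push_cast; ring
    have h2 : exp (-(Real.pi / 2 * I)) = -I := by rw [exp_neg, exp_pi_div_two_mul_I, inv_I]
    simp only [hk, hz, sinh_add_half_pi_mul_I]
    rw [h1, exp_add, exp_add, h2]
    have := hcosh x
    field_simp
  have hconst : ∀ s, HasDerivAt (fun s ↦ exp (-J s) * (1 - w s)) 0 s := fun s ↦ by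
    have hw' : HasDerivAt w (w s * (Real.pi * I * (2 * 1 * I))) s :=
      ((((hasDerivAt_id (s : ℂ)).comp_ofReal.const_mul 2).mul_const I |>.const_add _).const_mul
        _).cexp
    convert! (hJ' s).neg.cexp.mul (hw'.const_sub 1) using 1
    have hS : sin (Real.pi * ((a + 1 + 2 * s * I) / 2)) ≠ 0 := fun h ↦ by
      obtain ⟨n, hn⟩ := sin_eq_zero_iff.1 h
      rw [mul_comm] at hn
      have hre := congrArg re (mul_right_cancel₀ (ofReal_ne_zero.2 Real.pi_ne_zero) hn)
      have : (a + 1) / 2 = n := by simpa using hre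
      rw [this] at h0 h1
      norm_cast at h0 h1
      lia
    have hww : w s = exp (Real.pi * I * (a + 1 + 2 * s * I) / 2) ^ 2 := by
      simp only [hw]; rw [← exp_nat_mul]; congr 1; push_cast; ring
    have h1w : 1 - w s = -(w s - 1) := by ring
    rw [hk_int, h1w, hw1, hww]
    generalize sin (Real.pi * ((a + 1 + 2 * s * I) / 2)) = S at hS ⊢
    generalize exp (Real.pi * I * (a + 1 + 2 * s * I) / 2) = E
    field_simp
    ring
  have hlim : Tendsto (fun s ↦ exp (-J s) * (1 - w s)) atTop (nhds 1) := by
    have he : Tendsto (fun s : ℝ ↦ Real.exp (-(Real.pi * s))) atTop (nhds 0) :=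
      Real.tendsto_exp_neg_atTop_nhds_zero.comp (tendsto_id.const_mul_atTop Real.pi_pos)
    have hJ0 : Tendsto J atTop (nhds 0) := by
      refine squeeze_zero_norm (fun s ↦ ?_)
        ((he.mul_const (∫ x : ℝ, 2 * Real.exp (-(1 - |a|) * |x|))).trans_eq (by rw [zero_mul]))
      rw [← MeasureTheory.integral_const_mul]
      exact MeasureTheory.norm_integral_le_of_norm_le (hgi.const_mul _) (.of_forall (hFb s))
    have hw0 : Tendsto w atTop (nhds 0) := by
      rw [tendsto_zero_iff_norm_tendsto_zero]
      refine (by simpa using he.mul he : Tendsto _ _ (nhds (0:ℝ))).congr fun s ↦ ?_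
      rw [hw, norm_exp, ← Real.exp_add]
      congr 1
      simp
      ring
    simpa using hJ0.neg.cexp.mul (hw0.const_sub 1)
  have hall : ∀ s, exp (-J s) * (1 - w s) = exp (-J 0) * (1 - w 0) := fun s ↦
    is_const_of_deriv_eq_zero (fun s ↦ (hconst s).differentiableAt) (fun s ↦ (hconst s).deriv) s 0
  have h0 := tendsto_nhds_unique (tendsto_const_nhds.congr fun s ↦ (hall s).symm) hlim
  have hJ0 : exp (J 0) = 1 - w 0 := by
    rw [exp_neg] at h0
    field_simp at h0
    exact h0.symm
  convert hJ0 using 2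
  · simp only [hJ, hk]
    congr 1 with x
    have : (2 * ((((a + 1) / 2 : ℝ)) : ℂ) - 1) = a + 2 * (0 : ℝ) * I := by push_cast; ring
    rw [this]
    change -exp (_ * z x) / (2 * z x * sinh (z x)) = _
    have := hz0 x
    have := hsinh x
    field_simp
  · simp only [hw]
    congr 1
    push_cast
    ring

lemma abs_sinh_re_le_norm_sinh (z : ℂ) : |Real.sinh z.re| ≤ ‖sinh z‖ := by
  rw [sinh, norm_div, RCLike.norm_ofNat, Real.sinh_eq, abs_div, abs_two]
  gcongr
  simpa [norm_exp] using abs_norm_sub_norm_le (exp z) (exp (-z))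

lemma sinh_ne_zero_of_mem_wedgeStrip {z : ℂ} (hz : z ∈ wedgeStrip) : sinh z ≠ 0 := by
  intro h
  have h1 := abs_sinh_re_le_norm_sinh z
  rw [h, norm_zero, abs_nonpos_iff, Real.sinh_eq_zero] at h1
  have him : 0 < z.im ∧ z.im < Real.pi := by
    rcases hz with ⟨h2, h3⟩ | ⟨h2, h3⟩ <;> exact ⟨by linarith, h3⟩
  have hzI : z = z.im * I := by
    apply Complex.ext <;> simp [h1]
  rw [hzI, sinh_mul_I, ← ofReal_sin] at h
  have := Real.sin_pos_of_pos_of_lt_pi him.1 him.2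
  exact mul_ne_zero (ofReal_ne_zero.2 this.ne') I_ne_zero h

lemma ne_zero_of_mem_wedgeStrip {z : ℂ} (hz : z ∈ wedgeStrip) : z ≠ 0 := by
  rintro rfl
  exact sinh_ne_zero_of_mem_wedgeStrip hz sinh_zero

lemma ofReal_mul_mem_wedgeStrip {c : ℝ} (hc : 0 < c) (hc1 : c ≤ 1) {z : ℂ}
    (hz : z ∈ wedgeStrip) : c * z ∈ wedgeStrip := by
  have him : z.im < Real.pi → c * z.im < Real.pi := fun h ↦
    (mul_lt_mul_of_pos_left h hc).trans_le (mul_le_of_le_one_left Real.pi_pos.le hc1)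
  refine hz.imp (fun h ↦ ?_) (fun h ↦ ?_)
  · exact ⟨by simpa using mul_lt_mul_of_pos_left h.1 hc, by simpa using him h.2⟩
  · exact ⟨by simpa using mul_lt_mul_of_pos_left h.1 hc, by simpa using him h.2⟩

lemma exists_mul_exp_le_norm_sinh {ε : ℝ} (hε : 0 < ε) :
    ∃ c > 0, ∀ z : ℂ, ε ≤ |z.re| → c * Real.exp |z.re| ≤ ‖sinh z‖ := by
  refine ⟨(1 - Real.exp (-(2 * ε))) / 2, ?_, fun z hz ↦ ?_⟩
  · have : Real.exp (-(2 * ε)) < 1 := by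
      rw [← Real.exp_zero, Real.exp_lt_exp]
      linarith
    linarith
  · refine le_trans ?_ (abs_sinh_re_le_norm_sinh z)
    rw [Real.abs_sinh, Real.sinh_eq]
    have h1 : Real.exp (-|z.re|) ≤ Real.exp (-(2 * ε)) * Real.exp |z.re| := by
      rw [← Real.exp_add, Real.exp_le_exp]
      linarith
    linarith

section

variable {r : ℕ} {t : ℝ}

lemma two_mul_div_eq (r : ℕ) (z : ℂ) : 2 * z / r = ((2 / r : ℝ) : ℂ) * z := by
  push_cast; ring

lemma sinh_two_mul_div_ne_zero (hr : 2 ≤ r) {z : ℂ} (hz : z ∈ wedgeStrip) :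
    sinh (2 * z / r) ≠ 0 := by
  have hr' : (2 : ℝ) ≤ r := by exact_mod_cast hr
  rw [two_mul_div_eq]
  exact sinh_ne_zero_of_mem_wedgeStrip (ofReal_mul_mem_wedgeStrip (by positivity)
    ((div_le_one (by linarith)).2 hr') hz)

lemma differentiableOn_phiIntegrand (hr : 2 ≤ r) :
    DifferentiableOn ℂ (phiIntegrand r t) wedgeStrip := by
  refine DifferentiableOn.div (by fun_prop) (by fun_prop) fun z hz ↦ ?_
  exact mul_ne_zero (mul_ne_zero (mul_ne_zero (by norm_num) (ne_zero_of_mem_wedgeStrip hz))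
    (sinh_ne_zero_of_mem_wedgeStrip hz)) (sinh_two_mul_div_ne_zero hr hz)

lemma decaysOnStrip_phiIntegrand (hr : 0 < r) (h0 : 0 ≤ t) (h1 : t ≤ 1) :
    DecaysOnStrip (phiIntegrand r t) (Real.pi / 2) := fun ε hε ↦ by
  have hr' : (0 : ℝ) < 2 / r := by positivity
  obtain ⟨c, hc, hcz⟩ := exists_mul_exp_le_norm_sinh hε
  obtain ⟨d, hd, hdz⟩ := exists_mul_exp_le_norm_sinh (mul_pos hr' hε)
  refine ⟨1 / (4 * ε * c * d), 2 / r, hr', fun z hz _ _ ↦ ?_⟩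
  have hs := hdz ((2 / r : ℝ) * z) (by
    rw [re_ofReal_mul, abs_mul, abs_of_pos hr']; gcongr)
  rw [re_ofReal_mul, abs_mul, abs_of_pos hr'] at hs
  have hnum : ‖exp ((2 * t - 1) * z)‖ ≤ Real.exp |z.re| := by
    rw [norm_exp, Real.exp_le_exp]
    have : ((2 * t - 1) * z).re = (2 * t - 1) * z.re := by
      have : (2 * t - 1 : ℂ) = ((2 * t - 1 : ℝ) : ℂ) := by push_cast; rfl
      rw [this, re_ofReal_mul]
    rw [this]
    refine (le_abs_self _).trans ?_
    rw [abs_mul]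
    exact mul_le_of_le_one_left (abs_nonneg _) (abs_le.2 ⟨by linarith, by linarith⟩)
  rw [phiIntegrand, two_mul_div_eq, norm_div, norm_mul, norm_mul, norm_mul, RCLike.norm_ofNat]
  calc _ ≤ Real.exp |z.re| / (4 * ε * (c * Real.exp |z.re|) *
        (d * Real.exp (2 / r * |z.re|))) := by
        gcongr
        · exact hz.trans (abs_re_le_norm z)
        · exact hcz z hz
    _ = _ := by
        rw [neg_mul, Real.exp_neg]
        field_simp

lemma differentiableOn_inv_mul_sinh :
    DifferentiableOn ℂ (fun z ↦ -1 / (2 * z * sinh z)) wedgeStrip :=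
  DifferentiableOn.div (by fun_prop) (by fun_prop) fun z hz ↦
    mul_ne_zero (mul_ne_zero two_ne_zero (ne_zero_of_mem_wedgeStrip hz))
      (sinh_ne_zero_of_mem_wedgeStrip hz)

lemma decaysOnStrip_inv_mul_sinh (H : ℝ) :
    DecaysOnStrip (fun z ↦ -1 / (2 * z * sinh z)) H := fun ε hε ↦ by
  obtain ⟨c, hc, hcz⟩ := exists_mul_exp_le_norm_sinh hε
  refine ⟨1 / (2 * ε * c), 1, one_pos, fun z hz _ _ ↦ ?_⟩
  rw [norm_div, norm_mul, norm_mul, RCLike.norm_ofNat, norm_neg, norm_one]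
  calc _ ≤ 1 / (2 * ε * (c * Real.exp |z.re|)) := by
        gcongr
        · exact hz.trans (abs_re_le_norm z)
        · exact hcz z hz
    _ = _ := by
        rw [neg_mul, one_mul, Real.exp_neg]
        field_simp

lemma quantumDilog_eq_lineIntegral (hr : 2 ≤ r) (h0 : 0 ≤ t) (h1 : t ≤ 1) :
    quantumDilog r t = lineIntegral (phiIntegrand r t) (Real.pi / 2) := by
  refine Tendsto.limUnder_eq (tendsto_const_nhds.congr' ?_)
  filter_upwards [Ioo_mem_nhdsGT Real.pi_pos] with ε hε
  exact ((decaysOnStrip_phiIntegrand (by lia) h0 h1).indentedIntegral_eq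
    (differentiableOn_phiIntegrand hr) (by positivity) (by linarith [Real.pi_pos])
    hε.1 hε.2).symm

lemma half_pi_line_mem_wedgeStrip (x : ℝ) : (x + (Real.pi / 2 : ℝ) * I : ℂ) ∈ wedgeStrip :=
  mem_wedgeStrip_of_im_pos (by simp [Real.pi_pos]) (by simp [Real.pi_pos])

lemma quantumDilog_sub (hr : 2 ≤ r) {u : ℝ} (ht0 : 0 ≤ t) (ht1 : t ≤ 1) (hu0 : 0 ≤ u)
    (hu1 : u ≤ 1) : quantumDilog r t - quantumDilog r u =
      lineIntegral (fun z ↦ phiIntegrand r t z - phiIntegrand r u z) (Real.pi / 2) := by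
  have hInt : ∀ v : ℝ, 0 ≤ v → v ≤ 1 → _ := fun v h0 h1 ↦
    (decaysOnStrip_phiIntegrand (r := r) (t := v) (by lia) h0 h1).integrable_line
      (differentiableOn_phiIntegrand hr).continuousOn (by positivity) (by linarith [Real.pi_pos])
  rw [quantumDilog_eq_lineIntegral hr ht0 ht1, quantumDilog_eq_lineIntegral hr hu0 hu1]
  exact (MeasureTheory.integral_sub (hInt t ht0 ht1) (hInt u hu0 hu1)).symm

/-- The functional equation of the quantum dilogarithm, exponentiated. -/
lemma exp_quantumDilog_sub_quantumDilog (hr : 2 ≤ r) (h0 : 0 ≤ t - 1 / r) (h1 : t + 1 / r ≤ 1) :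
    exp (quantumDilog r (t - 1 / r) - quantumDilog r (t + 1 / r)) =
      1 - exp (2 * Real.pi * I * t) := by
  have hr' : (0 : ℝ) < 1 / r := by
    have : (0 : ℝ) < r := by exact_mod_cast (by lia : 0 < r)
    positivity
  rw [← exp_integral_eq_one_sub_exp (by linarith) (by linarith),
    quantumDilog_sub hr h0 (by linarith) (by linarith) h1, lineIntegral]
  congr 2 with x
  have hw := half_pi_line_mem_wedgeStrip x
  generalize (x + (Real.pi / 2 : ℝ) * I : ℂ) = z at hw
  have hz0 := ne_zero_of_mem_wedgeStrip hw
  have hs := sinh_ne_zero_of_mem_wedgeStrip hw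
  have hs' := sinh_two_mul_div_ne_zero hr hw
  have e1 : (2 * ((t - 1 / r : ℝ) : ℂ) - 1) * z = (2 * t - 1) * z + -(2 * z / r) := by
    push_cast; ring
  have e2 : (2 * ((t + 1 / r : ℝ) : ℂ) - 1) * z = (2 * t - 1) * z + 2 * z / r := by
    push_cast; ring
  have hsinh : exp (2 * z / r) - exp (-(2 * z / r)) = 2 * sinh (2 * z / r) := by
    rw [sinh]; ring
  rw [phiIntegrand, phiIntegrand, e1, e2, exp_add, exp_add]
  generalize sinh (2 * z / r) = S at hs' hsinh ⊢
  field_simp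
  linear_combination -2 * hsinh

lemma exp_quantumDilog_zero_sub_quantumDilog_one (hr : 2 ≤ r) :
    exp (quantumDilog r 0 - quantumDilog r 1) = 2 := by
  have hr2 : (2 : ℝ) ≤ r := by exact_mod_cast hr
  have hπ := Real.pi_pos
  have hshift : ∀ H : ℝ, 0 < H → H < Real.pi →
      indentedIntegral (fun z ↦ -1 / (2 * z * sinh z)) 1 =
        lineIntegral (fun z ↦ -1 / (2 * z * sinh z)) H := fun H h0 h1 ↦
    (decaysOnStrip_inv_mul_sinh H).indentedIntegral_eq differentiableOn_inv_mul_sinh h0 h1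
      one_pos (by linarith [Real.pi_gt_three])
  have hscale : quantumDilog r 0 - quantumDilog r 1 =
      lineIntegral (fun z ↦ -1 / (2 * z * sinh z)) (Real.pi / r) := by
    rw [quantumDilog_sub hr le_rfl zero_le_one zero_le_one le_rfl]
    have hsub := MeasureTheory.Measure.integral_comp_mul_left
      (fun x : ℝ ↦ -1 / (2 * (x + (Real.pi / r : ℝ) * I) * sinh (x + (Real.pi / r : ℝ) * I)))
      (2 / r : ℝ)
    rw [abs_of_pos (by positivity), eq_inv_smul_iff₀ (by positivity),
      ← MeasureTheory.integral_smul] at hsub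
    rw [lineIntegral, lineIntegral, ← hsub]
    congr 1 with x
    have hw := half_pi_line_mem_wedgeStrip x
    have hz : (((2 / r * x : ℝ) : ℂ) + (Real.pi / r : ℝ) * I) =
        2 * (x + (Real.pi / 2 : ℝ) * I) / r := by
      push_cast; ring
    rw [hz]
    generalize (x + (Real.pi / 2 : ℝ) * I : ℂ) = z at hw
    have hz0 := ne_zero_of_mem_wedgeStrip hw
    have hs := sinh_ne_zero_of_mem_wedgeStrip hw
    have hs' := sinh_two_mul_div_ne_zero hr hw
    have hrc : (r : ℂ) ≠ 0 := by exact_mod_cast (by lia : r ≠ 0)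
    have e1 : (2 * ((0 : ℝ) : ℂ) - 1) * z = -z := by push_cast; ring
    have e2 : (2 * ((1 : ℝ) : ℂ) - 1) * z = z := by push_cast; ring
    have hsinh : exp z - exp (-z) = 2 * sinh z := by rw [sinh]; ring
    rw [phiIntegrand, phiIntegrand, e1, e2, real_smul]
    generalize sinh (2 * z / r) = S at hs' ⊢
    push_cast
    field_simp
    linear_combination -2 * hsinh
  rw [hscale, ← hshift _ (by positivity) (div_lt_self hπ (by linarith)),
    hshift (Real.pi / 2) (by positivity) (by linarith), lineIntegral]
  have := exp_integral_eq_one_sub_exp (t := 1 / 2) (by norm_num) (by norm_num)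
  have h2 : 2 * Real.pi * I * ((1 / 2 : ℝ) : ℂ) = Real.pi * I := by push_cast; ring
  rw [h2, exp_pi_mul_I] at this
  convert! this using 4
  · simp
  · norm_num

end

lemma prod_one_sub_pow_eq_exp_of_le {p m : ℕ} (hp : 0 < p) (hm : m ≤ p) :
    ∏ k ∈ Finset.Icc 1 m, (1 - exp (4 * Real.pi * I / (2 * p + 1 : ℕ)) ^ k) =
      exp (quantumDilog (2 * p + 1) (1 / (2 * p + 1 : ℕ)) -
        quantumDilog (2 * p + 1) ((2 * m + 1) / (2 * p + 1 : ℕ))) := by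
  induction m with
  | zero => simp
  | succ m ih =>
    have hr : (0 : ℝ) < (2 * p + 1 : ℕ) := by positivity
    have hm' : (m : ℝ) + 1 ≤ p := by exact_mod_cast hm
    have hstep := exp_quantumDilog_sub_quantumDilog (r := 2 * p + 1)
      (t := 2 * (m + 1) / (2 * p + 1 : ℕ)) (by lia)
      (by rw [← sub_div]; exact div_nonneg (by linarith [m.cast_nonneg (α := ℝ)]) hr.le)
      (by rw [← add_div, div_le_one hr]; push_cast; linarith)
    rw [← sub_div, ← add_div] at hstep
    rw [Finset.prod_Icc_succ_top (by lia), ih (by lia)]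
    have hq : exp (4 * Real.pi * I / (2 * p + 1 : ℕ)) ^ (m + 1) =
        exp (2 * Real.pi * I * (2 * (m + 1) / (2 * p + 1 : ℕ) : ℝ)) := by
      rw [← exp_nat_mul]; congr 1; push_cast; ring
    rw [hq, ← hstep, ← exp_add]
    have h1 : (2 * ((m : ℝ) + 1) - 1) = 2 * m + 1 := by ring
    rw [h1]
    push_cast
    congr 1
    ring

lemma prod_one_sub_pow_eq_exp_add {p j : ℕ} (hp : 0 < p) (hj : j ≤ p) :
    ∏ k ∈ Finset.Icc 1 (p + j), (1 - exp (4 * Real.pi * I / (2 * p + 1 : ℕ)) ^ k) =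
      exp (quantumDilog (2 * p + 1) (1 / (2 * p + 1 : ℕ)) -
        quantumDilog (2 * p + 1) (2 * j / (2 * p + 1 : ℕ)) + Real.log 2) := by
  have hr : (0 : ℝ) < (2 * p + 1 : ℕ) := by positivity
  induction j with
  | zero =>
    have hlog : exp (Real.log 2 : ℝ) = 2 := by
      rw [← ofReal_exp, Real.exp_log two_pos]; norm_num
    rw [add_zero, prod_one_sub_pow_eq_exp_of_le hp le_rfl, exp_add, hlog,
      ← exp_quantumDilog_zero_sub_quantumDilog_one (r := 2 * p + 1) (by lia), ← exp_add]
    have h1 : ((2 * p + 1 : ℝ) / (2 * p + 1 : ℕ)) = 1 := by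
      push_cast at hr ⊢; exact div_self hr.ne'
    rw [h1]
    simp
  | succ j ih =>
    have hj' : (j : ℝ) + 1 ≤ p := by exact_mod_cast hj
    have hstep := exp_quantumDilog_sub_quantumDilog (r := 2 * p + 1)
      (t := (2 * j + 1) / (2 * p + 1 : ℕ)) (by lia)
      (by rw [← sub_div]; exact div_nonneg (by linarith [j.cast_nonneg (α := ℝ)]) hr.le)
      (by rw [← add_div, div_le_one hr]; push_cast; linarith)
    rw [← sub_div, ← add_div] at hstep
    rw [← add_assoc, Finset.prod_Icc_succ_top (by lia), ih (by lia)]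
    have hq : exp (4 * Real.pi * I / (2 * p + 1 : ℕ)) ^ (p + j + 1) =
        exp (2 * Real.pi * I * ((2 * j + 1) / (2 * p + 1 : ℕ) : ℝ)) := by
      rw [← exp_nat_mul, ← exp_periodic (2 * Real.pi * I * ((2 * j + 1) / (2 * p + 1 : ℕ) : ℝ))]
      congr 1
      have : (2 * p + 1 : ℂ) ≠ 0 := by exact_mod_cast (by lia : 2 * p + 1 ≠ 0)
      push_cast
      rw [eq_comm, ← sub_eq_zero]
      field_simp
      ring
    rw [hq, ← hstep, ← exp_add]
    have h1 : (2 * (j : ℝ) + 1 - 1) = 2 * j := by ring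
    have h2 : (2 * (j : ℝ) + 1 + 1) = 2 * (j + 1) := by ring
    rw [h1, h2]
    push_cast
    congr 1
    ring

theorem qPochhammer_eq_quantumDilog_large
    (r : ℕ) (hr : Odd r) (hr3 : 3 ≤ r) (q : ℂ)
    (hq : q = Complex.exp (4 * Real.pi * I / r))
    (n : ℕ) (hn₁ : r - 1 < 2 * n) (hn₂ : 2 * n < 2 * r - 1) :
    (∏ k ∈ Finset.Icc 1 n, (1 - q ^ k)) =
      Complex.exp (quantumDilog r (1 / r) - quantumDilog r ((2 * n + 1) / r - 1)
        + Real.log 2) := by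
  obtain ⟨p, rfl⟩ := hr
  obtain ⟨j, rfl⟩ := Nat.exists_eq_add_of_le (by lia : p ≤ n)
  rw [hq, prod_one_sub_pow_eq_exp_add (by lia) (by lia)]
  have : (2 * ((p + j : ℕ) : ℝ) + 1) / (2 * p + 1 : ℕ) - 1 = 2 * j / (2 * p + 1 : ℕ) := by
    have : (2 * p + 1 : ℝ) ≠ 0 := by positivity
    push_cast
    field_simp
    ring
  rw [this]
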